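/- I_c(ρ) = 0 if and only if ρ = ρ_A ⊗ ρ_B, for any bipartite density matrix ρ on a finite-dimensional tensor product Hilbert space. -/

import Mathlib

open scoped BigOperators Classical ComplexOrder
open Matrix Kronecker

noncomputable section

/-- Shannon entropy (base 2) of a finitely supported nonnegative function. -/
def H2 {α : Type} [Fintype α] (p : α → ℝ) : ℝ := ∑ x, -(p x * Real.logb 2 (p x))

/-- Marginal on the first factor. -/
def margA {α β : Type} [Fintype α] [Fintype β] (p : α × β → ℝ) : α → ℝ :=
  fun a => ∑ b, p (a, b)

/-- Marginal on the second factor. -/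
def margB {α β : Type} [Fintype α] [Fintype β] (p : α × β → ℝ) : β → ℝ :=
  fun b => ∑ a, p (a, b)

/-- Classical mutual information (base 2) of a joint distribution. -/
def mi {α β : Type} [Fintype α] [Fintype β] (p : α × β → ℝ) : ℝ :=
  H2 (margA p) + H2 (margB p) - H2 p

/-- Kullback–Leibler divergence in bits. -/
def klDiv {α : Type} [Fintype α] (ν μ : α → ℝ) : ℝ :=
  ∑ x, ν x * Real.logb 2 (ν x / μ x)

/-- ℓ₁ distance between two functions. -/
def l1 {α : Type} [Fintype α] (ν μ : α → ℝ) : ℝ := ∑ x, |ν x - μ x|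

/-- `p` is a probability distribution. -/
def IsProb {α : Type} [Fintype α] (p : α → ℝ) : Prop :=
  (∀ x, 0 ≤ p x) ∧ ∑ x, p x = 1

/-- Probability of an event. -/
def prE {Ω : Type} [Fintype Ω] (p : Ω → ℝ) (E : Ω → Prop) : ℝ :=
  ∑ ω, if E ω then p ω else 0

/-- Conditional distribution given an event. -/
def condP {Ω : Type} [Fintype Ω] (p : Ω → ℝ) (E : Ω → Prop) : Ω → ℝ :=
  fun ω => if E ω then p ω / prE p E else 0

/-- Distribution of a random variable. -/
def distOf {Ω α : Type} [Fintype Ω] (p : Ω → ℝ) (X : Ω → α) : α → ℝ :=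
  fun x => prE p (fun ω => X ω = x)

/-- Joint distribution of a pair of random variables. -/
def jointOf {Ω α β : Type} [Fintype Ω] (p : Ω → ℝ) (X : Ω → α) (Y : Ω → β)
    [Fintype α] [Fintype β] : α × β → ℝ :=
  fun xy => prE p (fun ω => X ω = xy.1 ∧ Y ω = xy.2)

/-- Mutual information between two random variables on a finite probability space. -/
def miRV {Ω α β : Type} [Fintype Ω] [Fintype α] [Fintype β]
    (p : Ω → ℝ) (X : Ω → α) (Y : Ω → β) : ℝ :=
  mi (jointOf p X Y)



/-- A density matrix: positive semidefinite with unit trace. -/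
def IsDensity {n : Type} [Fintype n] [DecidableEq n] (ρ : Matrix n n ℂ) : Prop :=
  ρ.PosSemidef ∧ ρ.trace = 1

/-- A POVM: positive semidefinite elements summing to the identity. -/
def IsPOVM {n ι : Type} [Fintype n] [DecidableEq n] [Fintype ι]
    (M : ι → Matrix n n ℂ) : Prop :=
  (∀ i, (M i).PosSemidef) ∧ ∑ i, M i = 1

/-- Partial trace over the second (Bob) factor: Alice's reduced state. -/
def trOutB {A B : Type} [Fintype A] [Fintype B]
    (ρ : Matrix (A × B) (A × B) ℂ) : Matrix A A ℂ :=
  Matrix.of fun a a' => ∑ b, ρ (a, b) (a', b)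

/-- Partial trace over the first (Alice) factor: Bob's reduced state. -/
def trOutA {A B : Type} [Fintype A] [Fintype B]
    (ρ : Matrix (A × B) (A × B) ℂ) : Matrix B B ℂ :=
  Matrix.of fun b b' => ∑ a, ρ (a, b) (a, b')

/-- von Neumann entropy in bits (via the eigenvalues of a Hermitian matrix). -/
def vN {n : Type} [Fintype n] [DecidableEq n] (ρ : Matrix n n ℂ) : ℝ :=
  if h : ρ.IsHermitian then ∑ i, -(h.eigenvalues i * Real.logb 2 (h.eigenvalues i)) else 0

/-- Quantum mutual information `S(ρ_A) + S(ρ_B) − S(ρ_AB)` in bits. -/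
def Iq {A B : Type} [Fintype A] [DecidableEq A] [Fintype B] [DecidableEq B]
    (ρ : Matrix (A × B) (A × B) ℂ) : ℝ :=
  vN (trOutB ρ) + vN (trOutA ρ) - vN ρ

/-- Trace norm (sum of singular values). -/
def traceNorm {n : Type} [Fintype n] [DecidableEq n] (M : Matrix n n ℂ) : ℝ :=
  ∑ i, Real.sqrt ((Matrix.posSemidef_conjTranspose_mul_self M).1.eigenvalues i)

/-- Outcome distribution of a local measurement `M_A ⊗ M_B` on a bipartite state. -/
def outcomeProb {A B J K : Type} [Fintype A] [Fintype B] [Fintype J] [Fintype K]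
    (ρ : Matrix (A × B) (A × B) ℂ)
    (MA : J → Matrix A A ℂ) (MB : K → Matrix B B ℂ) : J × K → ℝ :=
  fun jk => ((MA jk.1 ⊗ₖ MB jk.2) * ρ).trace.re

/-- The set of classical mutual informations achievable by local POVMs. -/
def IcSet {A B : Type} [Fintype A] [DecidableEq A] [Fintype B] [DecidableEq B]
    (ρ : Matrix (A × B) (A × B) ℂ) : Set ℝ :=
  {r | ∃ (J K : Type) (_ : Fintype J) (_ : Fintype K)
        (MA : J → Matrix A A ℂ) (MB : K → Matrix B B ℂ),
        IsPOVM MA ∧ IsPOVM MB ∧ r = mi (outcomeProb ρ MA MB)}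

/-- Maximal classical mutual information obtainable by local measurements. -/
def Ic {A B : Type} [Fintype A] [DecidableEq A] [Fintype B] [DecidableEq B]
    (ρ : Matrix (A × B) (A × B) ℂ) : ℝ :=
  sSup (IcSet ρ)

/-- Rank-one projector (outer product) `|v⟩⟨v|`. -/
def outer {n : Type} [Fintype n] (v : n → ℂ) : Matrix n n ℂ :=
  Matrix.of fun i i' => v i * star (v i')

/-- The expectation `⟨φ|M|φ⟩` (real part). -/
def qexp {n : Type} [Fintype n] (φ : n → ℂ) (M : Matrix n n ℂ) : ℝ :=
  (∑ i, ∑ i', star (φ i) * M i i' * φ i').re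

/-- The set of mutual informations between the ensemble label and the outcome of a POVM. -/
def IaccSet {n I : Type} [Fintype n] [DecidableEq n] [Fintype I]
    (p : I → ℝ) (η : I → Matrix n n ℂ) : Set ℝ :=
  {r | ∃ (J : Type) (_ : Fintype J) (M : J → Matrix n n ℂ), IsPOVM M ∧
        r = mi (fun ij : I × J => p ij.1 * ((M ij.2) * (η ij.1)).trace.re)}

/-- Accessible information of an ensemble. -/
def Iacc {n I : Type} [Fintype n] [DecidableEq n] [Fintype I]
    (p : I → ℝ) (η : I → Matrix n n ℂ) : ℝ :=
  sSup (IaccSet p η)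

/-- Matrix logarithm (base 2) of a Hermitian matrix, via spectral decomposition. -/
def matLog {n : Type} [Fintype n] [DecidableEq n] (M : Matrix n n ℂ) : Matrix n n ℂ :=
  if h : M.IsHermitian then
    (h.eigenvectorUnitary : Matrix n n ℂ) *
      Matrix.diagonal (fun i => (Real.logb 2 (h.eigenvalues i) : ℂ)) *
      star (h.eigenvectorUnitary : Matrix n n ℂ)
  else 0

/-- Quantum relative entropy `Tr ν log₂ ν − Tr ν log₂ μ`. -/
def qRelEnt {n : Type} [Fintype n] [DecidableEq n] (ν μ : Matrix n n ℂ) : ℝ :=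
  ((ν * matLog ν).trace - (ν * matLog μ).trace).re

open scoped MatrixOrder Matrix.Norms.L2Operator in
theorem span_posSemidef {n : Type} [Fintype n] [DecidableEq n] :
    Submodule.span ℂ {P : Matrix n n ℂ | P.PosSemidef} = ⊤ := by
  have h := CStarAlgebra.span_nonneg (A := Matrix n n ℂ)
  simpa only [Matrix.nonneg_iff_posSemidef] using h

open scoped MatrixOrder Matrix.Norms.L2Operator in
/-- The trace of a product of positive semidefinite matrices is nonnegative. -/
theorem trace_mul_nonneg_of_posSemidef {n : Type} [Fintype n] [DecidableEq n]
    {P Q : Matrix n n ℂ} (hP : P.PosSemidef) (hQ : Q.PosSemidef) : 0 ≤ (P * Q).trace := by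
  obtain ⟨X, rfl⟩ := CStarAlgebra.nonneg_iff_eq_star_mul_self.1
    (Matrix.nonneg_iff_posSemidef.2 hP)
  rw [Matrix.mul_assoc, Matrix.trace_mul_comm]
  exact (hQ.mul_mul_conjTranspose_same X).trace_nonneg

open scoped MatrixOrder Matrix.Norms.L2Operator in
/-- A positive semidefinite matrix is at most its trace times the identity. -/
theorem posSemidef_trace_smul_one_sub {n : Type} [Fintype n] [DecidableEq n]
    {P : Matrix n n ℂ} (hP : P.PosSemidef) : ((P.trace.re : ℂ) • 1 - P).PosSemidef := by
  have h : P ≤ algebraMap ℝ (Matrix n n ℂ) P.trace.re := by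
    refine le_algebraMap_of_spectrum_le (fun x hx => ?_) hP.1
    rw [hP.1.spectrum_real_eq_range_eigenvalues] at hx
    obtain ⟨i, rfl⟩ := hx
    have ht : P.trace.re = ∑ i, hP.1.eigenvalues i := by
      rw [hP.1.trace_eq_sum_eigenvalues]; simp
    rw [ht]
    exact Finset.single_le_sum (fun j _ => hP.eigenvalues_nonneg j) (Finset.mem_univ i)
  rw [Matrix.le_iff] at h
  have e : algebraMap ℝ (Matrix n n ℂ) P.trace.re = (P.trace.re : ℂ) • 1 := by
    rw [Algebra.algebraMap_eq_smul_one]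
    ext i j
    simp [Matrix.smul_apply]
  rwa [e] at h

/-- The bilinear form `(P, Q) ↦ Tr ((P ⊗ Q) ρ)`. -/
def localTrace {A B : Type} [Fintype A] [Fintype B] (ρ : Matrix (A × B) (A × B) ℂ) :
    Matrix A A ℂ →ₗ[ℂ] Matrix B B ℂ →ₗ[ℂ] ℂ :=
  LinearMap.mk₂ ℂ (fun P Q => ((P ⊗ₖ Q) * ρ).trace)
    (fun P P' Q => by rw [Matrix.add_kronecker, Matrix.add_mul, Matrix.trace_add])
    (fun c P Q => by rw [Matrix.smul_kronecker, Matrix.smul_mul, Matrix.trace_smul])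
    (fun P Q Q' => by rw [Matrix.kronecker_add, Matrix.add_mul, Matrix.trace_add])
    (fun c P Q => by rw [Matrix.kronecker_smul, Matrix.smul_mul, Matrix.trace_smul])

section LocalTrace

variable {A B : Type} [Fintype A] [Fintype B]

theorem localTrace_apply (ρ : Matrix (A × B) (A × B) ℂ) (P : Matrix A A ℂ) (Q : Matrix B B ℂ) :
    localTrace ρ P Q = ((P ⊗ₖ Q) * ρ).trace := rfl

theorem localTrace_one_right [DecidableEq B] (ρ : Matrix (A × B) (A × B) ℂ) (P : Matrix A A ℂ) :
    localTrace ρ P 1 = (P * trOutB ρ).trace := by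
  simp only [localTrace_apply, Matrix.trace, Matrix.diag, Matrix.mul_apply,
    Fintype.sum_prod_type, Matrix.kronecker_apply, Matrix.one_apply, trOutB, Matrix.of_apply,
    mul_ite, mul_one, mul_zero, ite_mul, zero_mul, Finset.sum_ite_eq, Finset.mem_univ, if_true,
    Finset.mul_sum]
  exact Finset.sum_congr rfl fun _ _ => Finset.sum_comm

theorem localTrace_one_left [DecidableEq A] (ρ : Matrix (A × B) (A × B) ℂ) (Q : Matrix B B ℂ) :
    localTrace ρ 1 Q = (Q * trOutA ρ).trace := by
  simp only [localTrace_apply, Matrix.trace, Matrix.diag, Matrix.mul_apply,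
    Fintype.sum_prod_type_right, Matrix.kronecker_apply, Matrix.one_apply, trOutA,
    Matrix.of_apply, ite_mul, one_mul, zero_mul, Finset.sum_ite_eq, Finset.mem_univ, if_true,
    Finset.mul_sum]
  exact Finset.sum_congr rfl fun _ _ => Finset.sum_comm

theorem localTrace_kronecker (σ : Matrix A A ℂ) (τ : Matrix B B ℂ) (P : Matrix A A ℂ)
    (Q : Matrix B B ℂ) : localTrace (σ ⊗ₖ τ) P Q = (P * σ).trace * (Q * τ).trace := by
  rw [localTrace_apply, ← Matrix.mul_kronecker_mul, Matrix.trace_kronecker]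

variable [DecidableEq A] [DecidableEq B]

theorem localTrace_single (ρ : Matrix (A × B) (A × B) ℂ) (a a' : A) (b b' : B) :
    localTrace ρ (Matrix.single a' a 1) (Matrix.single b' b 1) = ρ (a, b) (a', b') := by
  rw [localTrace_apply, Matrix.single_kronecker_single, Matrix.trace_single_mul]
  simp

theorem localTrace_one_right_single (ρ : Matrix (A × B) (A × B) ℂ) (a a' : A) :
    localTrace ρ (Matrix.single a' a 1) 1 = trOutB ρ a a' := by
  rw [localTrace_one_right, Matrix.trace_single_mul]
  simp

theorem localTrace_one_left_single (ρ : Matrix (A × B) (A × B) ℂ) (b b' : B) :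
    localTrace ρ 1 (Matrix.single b' b 1) = trOutA ρ b b' := by
  rw [localTrace_one_left, Matrix.trace_single_mul]
  simp

theorem localTrace_nonneg {ρ : Matrix (A × B) (A × B) ℂ} (hρ : ρ.PosSemidef)
    {P : Matrix A A ℂ} (hP : P.PosSemidef) {Q : Matrix B B ℂ} (hQ : Q.PosSemidef) :
    0 ≤ localTrace ρ P Q :=
  trace_mul_nonneg_of_posSemidef (hP.kronecker hQ) hρ

/-- Factorization of `localTrace` on positive semidefinite matrices forces `ρ` to be a product. -/
theorem eq_kronecker_of_localTrace_eq_mul {ρ : Matrix (A × B) (A × B) ℂ}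
    (h : ∀ (P : Matrix A A ℂ) (Q : Matrix B B ℂ), P.PosSemidef → Q.PosSemidef →
      localTrace ρ P Q = localTrace ρ P 1 * localTrace ρ 1 Q) :
    ρ = trOutB ρ ⊗ₖ trOutA ρ := by
  have hleft : ∀ (P : Matrix A A ℂ), P.PosSemidef →
      localTrace ρ P = localTrace ρ P 1 • localTrace ρ 1 := fun P hP =>
    LinearMap.ext_on span_posSemidef fun Q hQ => h P Q hP hQ
  have hall : localTrace ρ =
      ((localTrace ρ).flip 1).smulRight (localTrace ρ 1) :=
    LinearMap.ext_on span_posSemidef fun P hP => hleft P hP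
  ext ⟨a, b⟩ ⟨a', b'⟩
  calc ρ (a, b) (a', b')
      = localTrace ρ (Matrix.single a' a 1) (Matrix.single b' b 1) :=
        (localTrace_single ρ a a' b b').symm
    _ = localTrace ρ (Matrix.single a' a 1) 1 * localTrace ρ 1 (Matrix.single b' b 1) :=
        LinearMap.congr_fun (LinearMap.congr_fun hall _) _
    _ = trOutB ρ a a' * trOutA ρ b b' := by
        rw [localTrace_one_right_single, localTrace_one_left_single]

end LocalTrace

section Outcome

variable {A B J K : Type} [Fintype A] [Fintype B] [Fintype J] [Fintype K] {ρ : Matrix (A × B) (A × B) ℂ}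
  {MA : J → Matrix A A ℂ} {MB : K → Matrix B B ℂ}

theorem margA_outcomeProb [DecidableEq B] (hB : IsPOVM MB) (j : J) :
    margA (outcomeProb ρ MA MB) j = (localTrace ρ (MA j) 1).re := by
  rw [← hB.2, map_sum, Complex.re_sum]
  rfl

theorem margB_outcomeProb [DecidableEq A] (hA : IsPOVM MA) (k : K) :
    margB (outcomeProb ρ MA MB) k = (localTrace ρ 1 (MB k)).re := by
  rw [← hA.2, map_sum, LinearMap.sum_apply, Complex.re_sum]
  rfl

variable [DecidableEq A] [DecidableEq B]

theorem isProb_outcomeProb (hρ : IsDensity ρ) (hA : IsPOVM MA) (hB : IsPOVM MB) :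
    IsProb (outcomeProb ρ MA MB) := by
  refine ⟨fun jk => (Complex.nonneg_iff.1 (localTrace_nonneg hρ.1 (hA.1 jk.1) (hB.1 jk.2))).1, ?_⟩
  rw [Fintype.sum_prod_type]
  change ∑ j, margA (outcomeProb ρ MA MB) j = 1
  simp only [margA_outcomeProb hB]
  rw [← Complex.re_sum, ← LinearMap.sum_apply, ← map_sum, hA.2, localTrace_apply,
    Matrix.one_kronecker_one, Matrix.one_mul, hρ.2, Complex.one_re]

theorem outcomeProb_le_trace_mul_margB (hρ : IsDensity ρ) (hA : IsPOVM MA) (hB : IsPOVM MB)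
    (j : J) (k : K) : outcomeProb ρ MA MB (j, k) ≤
      (MA j).trace.re * margB (outcomeProb ρ MA MB) k := by
  rw [margB_outcomeProb hA]
  have h := (Complex.nonneg_iff.1 (localTrace_nonneg hρ.1
    (posSemidef_trace_smul_one_sub (hA.1 j)) (hB.1 k))).1
  rw [map_sub, LinearMap.sub_apply, map_smul, LinearMap.smul_apply, Complex.sub_re, smul_eq_mul,
    Complex.re_ofReal_mul] at h
  exact sub_nonneg.1 h

end Outcome

section MutualInformation

variable {α β : Type} [Fintype α] [Fintype β] {p : α × β → ℝ}

theorem le_margA (hp : ∀ x, 0 ≤ p x) (a : α) (b : β) : p (a, b) ≤ margA p a :=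
  Finset.single_le_sum (f := fun b => p (a, b)) (fun _ _ => hp _) (Finset.mem_univ b)

theorem le_margB (hp : ∀ x, 0 ≤ p x) (a : α) (b : β) : p (a, b) ≤ margB p b :=
  Finset.single_le_sum (f := fun a => p (a, b)) (fun _ _ => hp _) (Finset.mem_univ a)

theorem mi_mul_log_two (p : α × β → ℝ) : mi p * Real.log 2 =
    ∑ a, ∑ b, p (a, b) * (Real.log (p (a, b)) - Real.log (margA p a) - Real.log (margB p b)) := by
  have h2 : Real.log 2 ≠ 0 := (Real.log_pos one_lt_two).ne'
  have hH : ∀ {γ : Type} [Fintype γ] (q : γ → ℝ),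
      H2 q * Real.log 2 = -∑ x, q x * Real.log (q x) := by
    intro γ _ q
    rw [H2, Finset.sum_mul, ← Finset.sum_neg_distrib]
    refine Finset.sum_congr rfl fun x _ => ?_
    rw [Real.logb]
    field_simp
  have hAe : ∑ a, margA p a * Real.log (margA p a) =
      ∑ a, ∑ b, p (a, b) * Real.log (margA p a) :=
    Finset.sum_congr rfl fun a _ => by rw [← Finset.sum_mul, margA]
  have hBe : ∑ b, margB p b * Real.log (margB p b) =
      ∑ a, ∑ b, p (a, b) * Real.log (margB p b) := by
    rw [Finset.sum_comm]
    exact Finset.sum_congr rfl fun b _ => by rw [← Finset.sum_mul, margB]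
  rw [mi, sub_mul, add_mul, hH, hH, hH, hAe, hBe, Fintype.sum_prod_type]
  simp only [mul_sub, Finset.sum_sub_distrib]
  ring

/-- Pointwise Gibbs inequality. -/
theorem sub_mul_le_mul_log {t x y : ℝ} (ht : 0 ≤ t) (hx : t ≤ x) (hy : t ≤ y) :
    t - x * y ≤ t * (Real.log t - Real.log x - Real.log y) := by
  rcases ht.eq_or_lt with rfl | ht
  · simpa using mul_nonneg hx hy
  · have hx' := ht.trans_le hx
    have hy' := ht.trans_le hy
    have h := Real.log_le_sub_one_of_pos (x := x * y / t) (by positivity)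
    rw [Real.log_div (by positivity) ht.ne', Real.log_mul hx'.ne' hy'.ne'] at h
    have h' := mul_le_mul_of_nonneg_left h ht.le
    have e : t * (x * y / t - 1) = x * y - t := by field_simp
    linarith

/-- Equality case of the pointwise Gibbs inequality. -/
theorem eq_mul_of_mul_log_eq {t x y : ℝ} (ht : 0 ≤ t) (hx : t ≤ x) (hy : t ≤ y)
    (h : t * (Real.log t - Real.log x - Real.log y) = t - x * y) : t = x * y := by
  rcases ht.eq_or_lt with rfl | ht
  · simpa using h
  · by_contra hne
    have hx' := ht.trans_le hx
    have hy' := ht.trans_le hy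
    have h1 := Real.log_lt_sub_one_of_pos (x := x * y / t) (by positivity)
      (fun h1 => hne ((div_eq_one_iff_eq ht.ne').1 h1).symm)
    rw [Real.log_div (by positivity) ht.ne', Real.log_mul hx'.ne' hy'.ne'] at h1
    have h' := mul_lt_mul_of_pos_left h1 ht
    have e : t * (x * y / t - 1) = x * y - t := by field_simp
    linarith

theorem mul_log_le {t x y c : ℝ} (ht : 0 ≤ t) (hx : t ≤ x) (hy : t ≤ y) (hc : t ≤ c * y) :
    t * (Real.log t - Real.log x - Real.log y) ≤ t * (c / x) := by
  rcases ht.eq_or_lt with rfl | ht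
  · simp
  · have hx' := ht.trans_le hx
    have hy' := ht.trans_le hy
    have h := Real.log_le_sub_one_of_pos (x := t / (x * y)) (by positivity)
    rw [Real.log_div ht.ne' (by positivity), Real.log_mul hx'.ne' hy'.ne'] at h
    have h1 : t / (x * y) ≤ c / x := by
      rw [div_le_div_iff₀ (by positivity) hx']
      nlinarith
    exact mul_le_mul_of_nonneg_left (by linarith) ht.le

theorem sum_sub_margA_mul_margB (hp : IsProb p) :
    ∑ a, ∑ b, (p (a, b) - margA p a * margB p b) = 0 := by
  have hA : ∑ a, margA p a = 1 := by rw [← hp.2, Fintype.sum_prod_type]; rfl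
  have hB : ∑ b, margB p b = 1 := by rw [← hp.2, Fintype.sum_prod_type_right]; rfl
  simp only [Finset.sum_sub_distrib, ← Finset.mul_sum, hB, mul_one, hA]
  rw [← Fintype.sum_prod_type, hp.2, sub_self]

theorem mi_nonneg (hp : IsProb p) : 0 ≤ mi p := by
  refine nonneg_of_mul_nonneg_left ?_ (Real.log_pos one_lt_two)
  rw [mi_mul_log_two, ← sum_sub_margA_mul_margB hp]
  exact Finset.sum_le_sum fun a _ => Finset.sum_le_sum fun b _ =>
    sub_mul_le_mul_log (hp.1 _) (le_margA hp.1 a b) (le_margB hp.1 a b)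

/-- Vanishing mutual information means independence. -/
theorem mi_eq_zero_iff (hp : IsProb p) :
    mi p = 0 ↔ ∀ a b, p (a, b) = margA p a * margB p b := by
  have hle : ∀ x ∈ (Finset.univ : Finset (α × β)), p x - margA p x.1 * margB p x.2 ≤
      p x * (Real.log (p x) - Real.log (margA p x.1) - Real.log (margB p x.2)) := fun x _ =>
    sub_mul_le_mul_log (hp.1 _) (le_margA hp.1 x.1 x.2) (le_margB hp.1 x.1 x.2)
  have hsum := sum_sub_margA_mul_margB hp
  have hmi := mi_mul_log_two p
  rw [← Fintype.sum_prod_type'] at hsum hmi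
  constructor
  · intro h a b
    rw [h, zero_mul, ← hsum] at hmi
    have h1 := (Finset.sum_eq_sum_iff_of_le hle).1 hmi (a, b) (Finset.mem_univ _)
    exact eq_mul_of_mul_log_eq (hp.1 _) (le_margA hp.1 a b) (le_margB hp.1 a b) h1.symm
  · intro h
    have h0 : mi p * Real.log 2 = 0 := by
      rw [hmi]
      refine Finset.sum_eq_zero fun ⟨a, b⟩ _ => ?_
      rcases eq_or_ne (p (a, b)) 0 with h0 | h0
      · simp [h0]
      · have h1 := h0
        rw [h a b] at h1
        rw [show Real.log (p (a, b)) = Real.log (margA p a) + Real.log (margB p b) by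
          rw [h a b, Real.log_mul (left_ne_zero_of_mul h1) (right_ne_zero_of_mul h1)]]
        ring
    exact (mul_eq_zero.1 h0).resolve_right (Real.log_pos one_lt_two).ne'

theorem mi_mul_log_two_le (hp : ∀ x, 0 ≤ p x) {c : α → ℝ} (hc : ∀ a, 0 ≤ c a)
    (h : ∀ a b, p (a, b) ≤ c a * margB p b) : mi p * Real.log 2 ≤ ∑ a, c a := by
  rw [mi_mul_log_two]
  refine Finset.sum_le_sum fun a _ => ?_
  calc _ ≤ ∑ b, p (a, b) * (c a / margA p a) := Finset.sum_le_sum fun b _ =>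
        mul_log_le (hp _) (le_margA hp a b) (le_margB hp a b) (h a b)
    _ = margA p a * (c a / margA p a) := by rw [← Finset.sum_mul]; rfl
    _ ≤ c a := by
        rcases eq_or_ne (margA p a) 0 with h0 | h0
        · simpa [h0] using hc a
        · rw [mul_div_cancel₀ _ h0]

end MutualInformation

section LocalMeasurement

variable {A B : Type} [Fintype A] [DecidableEq A] [Fintype B] [DecidableEq B]
  {ρ : Matrix (A × B) (A × B) ℂ}

theorem bddAbove_IcSet (hρ : IsDensity ρ) : BddAbove (IcSet ρ) := by
  refine ⟨Fintype.card A / Real.log 2, ?_⟩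
  rintro r ⟨J, K, _, _, MA, MB, hA, hB, rfl⟩
  rw [le_div_iff₀ (Real.log_pos one_lt_two)]
  refine (mi_mul_log_two_le (isProb_outcomeProb hρ hA hB).1
    (fun j => (Complex.nonneg_iff.1 (hA.1 j).trace_nonneg).1)
    (outcomeProb_le_trace_mul_margB hρ hA hB)).trans_eq ?_
  rw [← Complex.re_sum, ← Matrix.trace_sum, hA.2, Matrix.trace_one]
  simp

theorem isPOVM_one {n : Type} [Fintype n] [DecidableEq n] :
    IsPOVM (fun _ : Unit => (1 : Matrix n n ℂ)) :=
  ⟨fun _ => Matrix.PosSemidef.one, by simp⟩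

/-- The two-outcome measurement of an effect. -/
theorem isPOVM_effect {n : Type} [Fintype n] [DecidableEq n] {E : Matrix n n ℂ}
    (h0 : E.PosSemidef) (h1 : (1 - E).PosSemidef) :
    IsPOVM (fun b : Bool => if b then E else 1 - E) :=
  ⟨fun b => by cases b <;> simpa, by simp⟩

/-- Every positive semidefinite matrix is a positive multiple of an effect. -/
theorem exists_effect {n : Type} [Fintype n] [DecidableEq n] {P : Matrix n n ℂ}
    (hP : P.PosSemidef) : ∃ (c : ℂ) (E : Matrix n n ℂ),
      P = c • E ∧ E.PosSemidef ∧ (1 - E).PosSemidef := by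
  have ht := (Complex.nonneg_iff.1 hP.trace_nonneg).1
  have hc : (0 : ℝ) < P.trace.re + 1 := by linarith
  have hcC : ((P.trace.re + 1 : ℝ) : ℂ) ≠ 0 := Complex.ofReal_ne_zero.2 hc.ne'
  have hinv : (0 : ℂ) ≤ ((P.trace.re + 1 : ℝ) : ℂ)⁻¹ := by
    rw [← Complex.ofReal_inv]
    exact Complex.zero_le_real.2 (inv_nonneg.2 hc.le)
  refine ⟨((P.trace.re + 1 : ℝ) : ℂ), ((P.trace.re + 1 : ℝ) : ℂ)⁻¹ • P, ?_, hP.smul hinv, ?_⟩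
  · rw [smul_smul, mul_inv_cancel₀ hcC, one_smul]
  · convert ((posSemidef_trace_smul_one_sub hP).add Matrix.PosSemidef.one).smul hinv using 1
    rw [sub_add_eq_add_sub, smul_sub]
    congr 1
    have e : (P.trace.re : ℂ) • (1 : Matrix n n ℂ) + 1 =
        ((P.trace.re + 1 : ℝ) : ℂ) • 1 := by
      rw [Complex.ofReal_add, Complex.ofReal_one, add_smul, one_smul]
    rw [e, smul_smul, inv_mul_cancel₀ hcC, one_smul]

theorem localTrace_effect_eq_mul (hρ : IsDensity ρ)
    (h : ∀ r ∈ IcSet ρ, r = 0) {E : Matrix A A ℂ} {F : Matrix B B ℂ}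
    (hE : E.PosSemidef) (hE' : (1 - E).PosSemidef) (hF : F.PosSemidef)
    (hF' : (1 - F).PosSemidef) :
    localTrace ρ E F = localTrace ρ E 1 * localTrace ρ 1 F := by
  have hA := isPOVM_effect hE hE'
  have hB := isPOVM_effect hF hF'
  have hmi := h _ ⟨Bool, Bool, inferInstance, inferInstance, _, _, hA, hB, rfl⟩
  have hind := (mi_eq_zero_iff (isProb_outcomeProb hρ hA hB)).1 hmi true true
  rw [margA_outcomeProb hB, margB_outcomeProb hA] at hind
  have hre : (localTrace ρ E F).re = (localTrace ρ E 1).re * (localTrace ρ 1 F).re := by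
    simpa [outcomeProb, localTrace_apply] using hind
  have h1 := Complex.nonneg_iff.1 (localTrace_nonneg hρ.1 hE hF)
  have h2 := Complex.nonneg_iff.1 (localTrace_nonneg hρ.1 hE Matrix.PosSemidef.one)
  have h3 := Complex.nonneg_iff.1 (localTrace_nonneg hρ.1 Matrix.PosSemidef.one hF)
  apply Complex.ext
  · rw [Complex.mul_re, ← h2.2, hre]; ring
  · rw [Complex.mul_im, ← h1.2, ← h2.2, ← h3.2]; ring

/-- If all local measurements give zero mutual information, the state is a product. -/
theorem eq_kronecker_of_forall_mem_IcSet (hρ : IsDensity ρ) (h : ∀ r ∈ IcSet ρ, r = 0) :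
    ρ = trOutB ρ ⊗ₖ trOutA ρ := by
  refine eq_kronecker_of_localTrace_eq_mul fun P Q hP hQ => ?_
  obtain ⟨c, E, rfl, hE, hE'⟩ := exists_effect hP
  obtain ⟨d, F, rfl, hF, hF'⟩ := exists_effect hQ
  simp only [map_smul, LinearMap.smul_apply, smul_eq_mul,
    localTrace_effect_eq_mul hρ h hE hE' hF hF']
  ring

theorem IcSet_nonempty (ρ : Matrix (A × B) (A × B) ℂ) : (IcSet ρ).Nonempty :=
  ⟨_, Unit, Unit, inferInstance, inferInstance, _, _, isPOVM_one, isPOVM_one, rfl⟩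

theorem IcSet_nonneg (hρ : IsDensity ρ) {r : ℝ} (hr : r ∈ IcSet ρ) : 0 ≤ r := by
  obtain ⟨J, K, _, _, MA, MB, hA, hB, rfl⟩ := hr
  exact mi_nonneg (isProb_outcomeProb hρ hA hB)

/-- Local measurements of a product state have zero mutual information. -/
theorem eq_zero_of_mem_IcSet (hρ : IsDensity ρ) (h : ρ = trOutB ρ ⊗ₖ trOutA ρ) {r : ℝ}
    (hr : r ∈ IcSet ρ) : r = 0 := by
  obtain ⟨J, K, _, _, MA, MB, hA, hB, rfl⟩ := hr
  rw [mi_eq_zero_iff (isProb_outcomeProb hρ hA hB)]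
  intro j k
  rw [margA_outcomeProb hB, margB_outcomeProb hA]
  have h1 : localTrace ρ (MA j) (MB k) = localTrace ρ (MA j) 1 * localTrace ρ 1 (MB k) := by
    rw [localTrace_one_right, localTrace_one_left, ← localTrace_kronecker, ← h]
  have h2 := Complex.nonneg_iff.1 (localTrace_nonneg hρ.1 (hA.1 j) Matrix.PosSemidef.one)
  change (localTrace ρ (MA j) (MB k)).re = _
  rw [h1, Complex.mul_re, ← h2.2, zero_mul, sub_zero]

end LocalMeasurement

/-- `I_c(ρ) = 0` if and only if `ρ = ρ_A ⊗ ρ_B`. -/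
theorem stmt_19 {A B : Type} [Fintype A] [DecidableEq A] [Fintype B] [DecidableEq B]
    (ρ : Matrix (A × B) (A × B) ℂ) (hρ : IsDensity ρ) :
    Ic ρ = 0 ↔ ρ = trOutB ρ ⊗ₖ trOutA ρ := by
  constructor
  · intro h
    exact eq_kronecker_of_forall_mem_IcSet hρ fun r hr =>
      le_antisymm ((le_csSup (bddAbove_IcSet hρ) hr).trans_eq h) (IcSet_nonneg hρ hr)
  · intro h
    have h0 := fun r hr => eq_zero_of_mem_IcSet (r := r) hρ h hr
    rw [Ic, (Set.Nonempty.subset_singleton_iff (IcSet_nonempty ρ)).1 h0, csSup_singleton]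

end
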